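/- Let N ≥ 2. Then lim_{s → 0⁺} s · P_s(B_1) / |B_1|^((N-2s)/N) = σ_{N-1}, where σ_{N-1} = 2π^(N/2)/Γ(N/2) is the (N-1)-dimensional volume of the unit sphere in ℝ^N. -/

import Mathlib

open MeasureTheory Real Filter
open scoped ENNReal Topology

/-- The fractional `s`-perimeter of a set `E ⊆ ℝ^N`:
`P_s(E) = ∫∫ |1_E(x) - 1_E(y)|² / |x-y|^(N+2s) dx dy`, as an element of `[0,∞]`. -/
noncomputable def fracPerimeter (N : ℕ) (s : ℝ) (E : Set (EuclideanSpace ℝ (Fin N))) : ℝ≥0∞ :=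
  ∫⁻ x, ∫⁻ y, ENNReal.ofReal
    (|E.indicator (fun _ => (1 : ℝ)) x - E.indicator (fun _ => (1 : ℝ)) y| ^ 2
      / ‖x - y‖ ^ ((N : ℝ) + 2 * s))

open Set in
lemma fp_tail (N : ℕ) (hN : 2 ≤ N) (s R : ℝ) (hs : 0 < s) (hR : 0 < R) :
    ∫⁻ z : EuclideanSpace ℝ (Fin N),
      ENNReal.ofReal ((Ici R).indicator (fun r : ℝ => 1 / r ^ ((N : ℝ) + 2 * s)) ‖z‖)
    = ENNReal.ofReal (N * volume.real (Metric.ball (0 : EuclideanSpace ℝ (Fin N)) 1)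
        * (R ^ (-(2 * s)) / (2 * s))) := by
  have : Nonempty (Fin N) := ⟨⟨0, by omega⟩⟩
  have hdim : Module.finrank ℝ (EuclideanSpace ℝ (Fin N)) = N := by simp
  set f : ℝ → ℝ := (Ici R).indicator (fun r : ℝ => 1 / r ^ ((N : ℝ) + 2 * s)) with hf
  have hlt : -1 - 2 * s < -1 := by linarith
  have heq : (fun y : ℝ => y ^ (N - 1) • f y) = (Ici R).indicator (fun r => r ^ (-1 - 2 * s)) := by
    funext y
    by_cases hy : y ∈ Ici R
    · have hy0 : 0 < y := lt_of_lt_of_le hR hy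
      simp only [hf, indicator_of_mem hy, smul_eq_mul]
      rw [← Real.rpow_natCast, one_div, ← Real.rpow_neg hy0.le, ← Real.rpow_add hy0]
      congr 1
      rw [Nat.cast_sub (by omega)]
      push_cast; ring
    · simp [hf, indicator_of_notMem hy]
  have hsub : Ioi 0 ∩ Ici R = Ici R := inter_eq_right.2 (fun y hy => lt_of_lt_of_le hR hy)
  have hint : Integrable (fun z : EuclideanSpace ℝ (Fin N) => f ‖z‖) := by
    rw [integrable_fun_norm_addHaar, hdim, heq, IntegrableOn, integrable_indicator_iff measurableSet_Ici,
      IntegrableOn, Measure.restrict_restrict measurableSet_Ici, inter_comm, hsub]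
    exact (integrableOn_Ici_iff_integrableOn_Ioi (by simp)).2 (integrableOn_Ioi_rpow_of_lt hlt hR)
  have hnn : ∀ r : ℝ, 0 ≤ r → 0 ≤ f r := fun r hr => by
    apply indicator_apply_nonneg; intro _; positivity
  rw [← ofReal_integral_eq_lintegral_ofReal hint (ae_of_all _ fun z => hnn _ (norm_nonneg _)),
    integral_fun_norm_addHaar, hdim, heq, setIntegral_indicator measurableSet_Ici, hsub,
    integral_Ici_eq_integral_Ioi, integral_Ioi_rpow_of_lt hlt hR]
  congr 1
  have e : -1 - 2 * s + 1 = -(2 * s) := by ring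
  rw [e]
  simp only [nsmul_eq_mul, smul_eq_mul]
  rw [neg_div_neg_eq]; ring

lemma fp_measK (N : ℕ) (s : ℝ) : Measurable
    (fun p : EuclideanSpace ℝ (Fin N) × EuclideanSpace ℝ (Fin N) =>
      ENNReal.ofReal (1 / ‖p.1 - p.2‖ ^ ((N : ℝ) + 2 * s))) := by
  fun_prop

lemma fp_split (N : ℕ) (s : ℝ) (B : Set (EuclideanSpace ℝ (Fin N))) (hB : MeasurableSet B) :
    fracPerimeter N s B = 2 * ∫⁻ x in B, ∫⁻ y in Bᶜ,
      ENNReal.ofReal (1 / ‖x - y‖ ^ ((N : ℝ) + 2 * s)) := by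
  set K : EuclideanSpace ℝ (Fin N) → EuclideanSpace ℝ (Fin N) → ℝ≥0∞ :=
    fun x y => ENNReal.ofReal (1 / ‖x - y‖ ^ ((N : ℝ) + 2 * s)) with hK
  have hKm : Measurable (Function.uncurry K) := fp_measK N s
  have hin : ∀ x, (∫⁻ y, ENNReal.ofReal
    (|B.indicator (fun _ => (1 : ℝ)) x - B.indicator (fun _ => (1 : ℝ)) y| ^ 2
      / ‖x - y‖ ^ ((N : ℝ) + 2 * s))) =
      B.indicator (fun x => ∫⁻ y in Bᶜ, K x y) x + Bᶜ.indicator (fun x => ∫⁻ y in B, K x y) x := by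
    intro x
    by_cases hx : x ∈ B
    · have hx' : x ∉ Bᶜ := fun h => h hx
      rw [Set.indicator_of_mem hx, Set.indicator_of_mem hx, Set.indicator_of_notMem hx', add_zero,
        ← lintegral_indicator hB.compl]
      congr 1; funext y
      by_cases hy : y ∈ B <;> simp [hy, hK]
    · have hx' : x ∈ Bᶜ := hx
      rw [Set.indicator_of_notMem hx, Set.indicator_of_notMem hx, Set.indicator_of_mem hx', zero_add,
        ← lintegral_indicator hB]
      congr 1; funext y
      by_cases hy : y ∈ B <;> simp [hy, hK]
  have hm : Measurable fun x => ∫⁻ y in Bᶜ, K x y := hKm.lintegral_prod_right'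
  unfold fracPerimeter
  simp_rw [hin]
  rw [lintegral_add_left (hm.indicator hB), lintegral_indicator hB, lintegral_indicator hB.compl,
    two_mul]
  congr 1
  rw [lintegral_lintegral_swap hKm.aemeasurable]
  simp only [hK, norm_sub_rev]

lemma fp_lower (N : ℕ) (hN : 2 ≤ N) (s : ℝ) (hs : 0 < s) (x : EuclideanSpace ℝ (Fin N))
    (hx : x ∈ Metric.ball (0 : EuclideanSpace ℝ (Fin N)) 1) :
    ENNReal.ofReal (N * volume.real (Metric.ball (0 : EuclideanSpace ℝ (Fin N)) 1)
        * ((2 : ℝ) ^ (-(2 * s)) / (2 * s))) ≤ 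
     ∫⁻ y in (Metric.ball (0 : EuclideanSpace ℝ (Fin N)) 1)ᶜ,
      ENNReal.ofReal (1 / ‖x - y‖ ^ ((N : ℝ) + 2 * s)) := by
  rw [← fp_tail N hN s 2 hs two_pos, ← lintegral_indicator measurableSet_ball.compl,
    ← lintegral_sub_left_eq_self _ x]
  refine lintegral_mono fun y => ?_
  dsimp only
  by_cases hy : ‖x - y‖ ∈ Set.Ici (2 : ℝ)
  · have : y ∈ (Metric.ball (0 : EuclideanSpace ℝ (Fin N)) 1)ᶜ := by
      simp only [Set.mem_compl_iff, mem_ball_zero_iff, Set.mem_Ici] at *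
      have := norm_sub_le x y
      linarith
    rw [Set.indicator_of_mem hy, Set.indicator_of_mem this]
  · rw [Set.indicator_of_notMem hy]; simp

lemma fp_upper (N : ℕ) (hN : 2 ≤ N) (s : ℝ) (hs : 0 < s) (x : EuclideanSpace ℝ (Fin N))
    (hx : x ∈ Metric.ball (0 : EuclideanSpace ℝ (Fin N)) 1) :
     ∫⁻ y in (Metric.ball (0 : EuclideanSpace ℝ (Fin N)) 1)ᶜ,
      ENNReal.ofReal (1 / ‖x - y‖ ^ ((N : ℝ) + 2 * s)) ≤
    ENNReal.ofReal (N * volume.real (Metric.ball (0 : EuclideanSpace ℝ (Fin N)) 1)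
        * ((1 - ‖x‖) ^ (-(2 * s)) / (2 * s))) := by
  have hx1 : ‖x‖ < 1 := by simpa using hx
  rw [← fp_tail N hN s (1 - ‖x‖) hs (by linarith), ← lintegral_indicator measurableSet_ball.compl,
    ← lintegral_sub_left_eq_self (fun z : EuclideanSpace ℝ (Fin N) => ENNReal.ofReal
      ((Set.Ici (1 - ‖x‖)).indicator (fun r : ℝ => 1 / r ^ ((N : ℝ) + 2 * s)) ‖z‖)) x]
  refine lintegral_mono fun y => ?_
  dsimp only
  by_cases hy : y ∈ (Metric.ball (0 : EuclideanSpace ℝ (Fin N)) 1)ᶜ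
  · have : ‖x - y‖ ∈ Set.Ici (1 - ‖x‖) := by
      simp only [Set.mem_compl_iff, mem_ball_zero_iff, Set.mem_Ici] at *
      have := norm_sub_norm_le y x
      rw [norm_sub_rev] at this
      linarith
    rw [Set.indicator_of_mem hy, Set.indicator_of_mem this]
  · rw [Set.indicator_of_notMem hy]; simp

lemma fp_integrable (N : ℕ) (hN : 2 ≤ N) (a : ℝ) (ha : a < 1) (ha0 : 0 ≤ a) :
    IntegrableOn (fun x : EuclideanSpace ℝ (Fin N) => (1 - ‖x‖) ^ (-a))
      (Metric.ball (0 : EuclideanSpace ℝ (Fin N)) 1) := by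
  have : Nonempty (Fin N) := ⟨⟨0, by omega⟩⟩
  rw [integrableOn_fun_norm_addHaar volume (f := fun r : ℝ => (1 - r) ^ (-a))]
  have h1 : IntervalIntegrable (fun r : ℝ => (1 - r) ^ (-a)) volume 0 1 := by
    have := (intervalIntegral.intervalIntegrable_rpow' (a := 0) (b := 1) (r := -a)
      (by linarith)).comp_sub_left 1
    simpa using this.symm
  have h2 := (h1.continuousOn_mul (g := fun r : ℝ => r ^ (Module.finrank ℝ (EuclideanSpace ℝ (Fin N)) - 1)) (by fun_prop))
  rw [intervalIntegrable_iff_integrableOn_Ioo_of_le zero_le_one] at h2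
  exact h2

lemma fp_tendsto_I (N : ℕ) (hN : 2 ≤ N) :
    Tendsto (fun s : ℝ => ∫ x in Metric.ball (0 : EuclideanSpace ℝ (Fin N)) 1,
      (1 - ‖x‖) ^ (-(2 * s))) (𝓝[Set.Ioo (0 : ℝ) (1 / 2)] 0)
      (𝓝 (volume.real (Metric.ball (0 : EuclideanSpace ℝ (Fin N)) 1))) := by
  have hv : volume.real (Metric.ball (0 : EuclideanSpace ℝ (Fin N)) 1) =
    ∫ x in Metric.ball (0 : EuclideanSpace ℝ (Fin N)) 1, (1 : ℝ) := by simp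
  rw [hv]
  have hev : ∀ᶠ s : ℝ in 𝓝[Set.Ioo (0 : ℝ) (1 / 2)] 0, s < 1 / 4 :=
    mem_nhdsWithin_of_mem_nhds (Iio_mem_nhds (by norm_num))
  apply tendsto_integral_filter_of_dominated_convergence
    (fun x => (1 - ‖x‖) ^ (-(1 / 2 : ℝ)))
  · exact Eventually.of_forall fun s => (by fun_prop : Measurable _).aestronglyMeasurable
  · filter_upwards [hev, self_mem_nhdsWithin] with s hs hs0
    refine (ae_restrict_iff' measurableSet_ball).2 (ae_of_all _ fun x hx => ?_)
    have hx1 : ‖x‖ < 1 := by simpa using hx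
    rw [Real.norm_of_nonneg (Real.rpow_nonneg (by linarith) _)]
    exact Real.rpow_le_rpow_of_exponent_ge (by linarith) (by linarith [norm_nonneg x]) (by linarith)
  · exact fp_integrable N hN _ (by norm_num) (by norm_num)
  · refine (ae_restrict_iff' measurableSet_ball).2 (ae_of_all _ fun x hx => ?_)
    have hx1 : ‖x‖ < 1 := by simpa using hx
    have hc : ContinuousAt (fun s : ℝ => (1 - ‖x‖) ^ (-(2 * s))) 0 :=
      ContinuousAt.rpow continuousAt_const (by fun_prop) (Or.inl (by simp; linarith))
    have := hc.tendsto.mono_left (nhdsWithin_le_nhds (s := Set.Ioo (0 : ℝ) (1 / 2)))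
    simpa using this

lemma fp_bounds (N : ℕ) (hN : 2 ≤ N) (s : ℝ) (hs : s ∈ Set.Ioo (0 : ℝ) (1 / 2)) :
    let v := volume.real (Metric.ball (0 : EuclideanSpace ℝ (Fin N)) 1)
    N * v * (2 : ℝ) ^ (-(2 * s)) * v ≤
      s * (fracPerimeter N s (Metric.ball (0 : EuclideanSpace ℝ (Fin N)) 1)).toReal ∧
      s * (fracPerimeter N s (Metric.ball (0 : EuclideanSpace ℝ (Fin N)) 1)).toReal ≤
      N * v * ∫ x in Metric.ball (0 : EuclideanSpace ℝ (Fin N)) 1, (1 - ‖x‖) ^ (-(2 * s)) := by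
  intro v
  obtain ⟨hs0, hs1⟩ := hs
  have hv : 0 ≤ v := measureReal_nonneg
  set B := Metric.ball (0 : EuclideanSpace ℝ (Fin N)) 1 with hB
  have hVt : volume B ≠ ⊤ := measure_ball_lt_top.ne
  have hI : IntegrableOn (fun x : EuclideanSpace ℝ (Fin N) => (1 - ‖x‖) ^ (-(2 * s))) B :=
    fp_integrable N hN _ (by linarith) (by linarith)
  set I := ∫ x in B, (1 - ‖x‖) ^ (-(2 * s)) with hIdef
  have hnn : ∀ x ∈ B, 0 ≤ (1 - ‖x‖) ^ (-(2 * s)) := fun x hx => by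
    have hx1 : ‖x‖ < 1 := by simpa [hB] using hx
    exact Real.rpow_nonneg (by linarith) _
  have hI0 : 0 ≤ I := setIntegral_nonneg measurableSet_ball hnn
  have hup : fracPerimeter N s B ≤ ENNReal.ofReal (N * v * I / s) := by
    rw [fp_split N s B measurableSet_ball]
    calc _ ≤ 2 * ∫⁻ x in B, ENNReal.ofReal (N * v * ((1 - ‖x‖) ^ (-(2 * s)) / (2 * s))) := by
          gcongr 2 * ?_
          exact setLIntegral_mono' measurableSet_ball fun x hx => fp_upper N hN s hs0 x hx
      _ = 2 * ENNReal.ofReal (∫ x in B, N * v * ((1 - ‖x‖) ^ (-(2 * s)) / (2 * s))) := by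
          rw [ofReal_integral_eq_lintegral_ofReal]
          · exact (hI.div_const _).const_mul _
          · refine (ae_restrict_iff' measurableSet_ball).2 (ae_of_all _ fun x hx => ?_)
            have := hnn x hx
            simp only [Pi.zero_apply]
            positivity
      _ = _ := by
          rw [integral_const_mul, integral_div, ← hIdef,
            show (2 : ℝ≥0∞) = ENNReal.ofReal 2 by simp, ← ENNReal.ofReal_mul (by norm_num)]
          congr 1; field_simp
  have hlow : ENNReal.ofReal (N * v * (2 : ℝ) ^ (-(2 * s)) * v / s) ≤ fracPerimeter N s B := by
    rw [fp_split N s B measurableSet_ball]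
    calc _ = 2 * ∫⁻ x in B, ENNReal.ofReal (N * v * ((2 : ℝ) ^ (-(2 * s)) / (2 * s))) := by
          have hVv : volume B = ENNReal.ofReal v := (ENNReal.ofReal_toReal hVt).symm
          rw [setLIntegral_const, hVv,
            show (2 : ℝ≥0∞) = ENNReal.ofReal 2 by simp, ← ENNReal.ofReal_mul (by positivity),
            ← ENNReal.ofReal_mul (by norm_num)]
          congr 1
          field_simp
      _ ≤ _ := by
          gcongr 2 * ?_
          exact setLIntegral_mono' measurableSet_ball fun x hx => fp_lower N hN s hs0 x hx
  have hfin : fracPerimeter N s B ≠ ⊤ := ne_top_of_le_ne_top ENNReal.ofReal_ne_top hup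
  have h1 := ENNReal.toReal_mono ENNReal.ofReal_ne_top hup
  have h2 := (ENNReal.ofReal_le_iff_le_toReal hfin).1 hlow
  rw [ENNReal.toReal_ofReal (by positivity), le_div_iff₀ hs0] at h1
  rw [div_le_iff₀ hs0] at h2
  constructor <;> linarith

lemma fp_sigma (N : ℕ) (hN : 2 ≤ N) :
    N * volume.real (Metric.ball (0 : EuclideanSpace ℝ (Fin N)) 1)
      = 2 * π ^ ((N : ℝ) / 2) / Gamma ((N : ℝ) / 2) := by
  have : Nonempty (Fin N) := ⟨⟨0, by omega⟩⟩
  have hN0 : (0 : ℝ) < N := by exact_mod_cast (by omega : 0 < N)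
  have hG : 0 < Gamma ((N : ℝ) / 2) := Real.Gamma_pos_of_pos (by positivity)
  rw [measureReal_def, EuclideanSpace.volume_ball]
  simp only [Fintype.card_fin, ENNReal.ofReal_one, one_pow, one_mul]
  rw [Real.Gamma_add_one (by positivity), ENNReal.toReal_ofReal (by positivity),
    Real.sqrt_eq_rpow, ← Real.rpow_natCast, ← Real.rpow_mul Real.pi_pos.le,
    show 1 / 2 * (N : ℝ) = N / 2 by ring]
  field_simp

theorem tendsto_smul_isoperimetric_quotient_zero (N : ℕ) (hN : 2 ≤ N) :
    Tendsto
      (fun s : ℝ => s *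
        (fracPerimeter N s (Metric.ball (0 : EuclideanSpace ℝ (Fin N)) 1)
          / (volume (Metric.ball (0 : EuclideanSpace ℝ (Fin N)) 1))
              ^ (((N : ℝ) - 2 * s) / N)).toReal)
      (𝓝[Set.Ioo (0 : ℝ) (1 / 2)] 0)
      (𝓝 (2 * π ^ ((N : ℝ) / 2) / Gamma ((N : ℝ) / 2))) := by
  have hN0 : (N : ℝ) ≠ 0 := by exact_mod_cast (by omega : N ≠ 0)
  rw [← fp_sigma N hN]
  set v := volume.real (Metric.ball (0 : EuclideanSpace ℝ (Fin N)) 1) with hv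
  have hvpos : 0 < v :=
    ENNReal.toReal_pos (Metric.measure_ball_pos volume _ one_pos).ne' measure_ball_lt_top.ne
  have hP : Tendsto (fun s : ℝ => s *
      (fracPerimeter N s (Metric.ball (0 : EuclideanSpace ℝ (Fin N)) 1)).toReal)
      (𝓝[Set.Ioo (0 : ℝ) (1 / 2)] 0) (𝓝 (N * v * v)) := by
    refine tendsto_of_tendsto_of_tendsto_of_le_of_le' (?_ : Tendsto
        (fun s : ℝ => N * v * (2 : ℝ) ^ (-(2 * s)) * v) _ _) ((fp_tendsto_I N hN).const_mul (N * v))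
      ?_ ?_
    · have hc : ContinuousAt (fun s : ℝ => N * v * (2 : ℝ) ^ (-(2 * s)) * v) 0 := by
        have : ContinuousAt (fun s : ℝ => (2 : ℝ) ^ (-(2 * s))) 0 :=
          ContinuousAt.rpow continuousAt_const (by fun_prop) (Or.inl (by norm_num))
        fun_prop
      have := hc.tendsto.mono_left (nhdsWithin_le_nhds (s := Set.Ioo (0 : ℝ) (1 / 2)))
      simpa using this
    · filter_upwards [self_mem_nhdsWithin] with s hs using (fp_bounds N hN s hs).1
    · filter_upwards [self_mem_nhdsWithin] with s hs using (fp_bounds N hN s hs).2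
  have hD : Tendsto (fun s : ℝ => v ^ (((N : ℝ) - 2 * s) / N))
      (𝓝[Set.Ioo (0 : ℝ) (1 / 2)] 0) (𝓝 v) := by
    have hc : ContinuousAt (fun s : ℝ => v ^ (((N : ℝ) - 2 * s) / N)) 0 :=
      ContinuousAt.rpow continuousAt_const (by fun_prop) (Or.inl hvpos.ne')
    have := hc.tendsto.mono_left (nhdsWithin_le_nhds (s := Set.Ioo (0 : ℝ) (1 / 2)))
    simpa [hN0] using this
  have := hP.div hD hvpos.ne'
  rw [mul_div_assoc, div_self hvpos.ne', mul_one] at this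
  refine this.congr fun s => ?_
  simp only [Pi.div_apply]
  rw [ENNReal.toReal_div, ← ENNReal.toReal_rpow, mul_div_assoc]
  rfl
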